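/- Let X be a compact metric space and f : X → X continuous such that f|_{CR(f)} has the shadowing property. Then h_top(f) > 0 if and only if there exists (x, y) ∈ CR(f)² with x ≠ y and x ~ y (chain relation). -/

import Mathlib

open Metric Filter Set
open scoped Classical

section Defs

variable {X : Type*} [MetricSpace X]

/-- `(c i)_{i=0}^k` is a δ-chain of `f`. -/
def IsChain' (f : X → X) (δ : ℝ) (c : ℕ → X) (k : ℕ) : Prop :=
  ∀ i < k, dist (f (c i)) (c (i + 1)) ≤ δ

/-- The chain recurrent set of `f`. -/
def CR (f : X → X) : Set X :=
  {x | ∀ δ > 0, ∃ k > 0, ∃ c : ℕ → X, IsChain' f δ c k ∧ c 0 = x ∧ c k = x}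

/-- The chain relation `~` on `CR f`. -/
def ChainRel (f : X → X) (x y : X) : Prop :=
  ∀ δ > 0, ∃ m > 0, ∃ N > 0, ∀ n ≥ N,
    (∃ c : ℕ → X, IsChain' f δ c (m * n) ∧ (∀ i ≤ m * n, c i ∈ CR f) ∧
      c 0 = x ∧ c (m * n) = y) ∧
    (∃ c : ℕ → X, IsChain' f δ c (m * n) ∧ (∀ i ≤ m * n, c i ∈ CR f) ∧
      c 0 = y ∧ c (m * n) = x)

/-- Property* for a pair `(z, w)`, with cycles lying in `CR f`. -/
def PropertyStar (f : X → X) (z w : X) : Prop :=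
  ∃ r > 0, ∀ δ > 0, ∃ k > 0, ∃ c c' : ℕ → X,
    IsChain' f δ c k ∧ IsChain' f δ c' k ∧
    (∀ i ≤ k, c i ∈ CR f) ∧ (∀ i ≤ k, c' i ∈ CR f) ∧
    c 0 = z ∧ c k = z ∧ c' 0 = w ∧ c' k = w ∧
    ∀ i ≤ k, dist (c i) (c' i) > r

/-- Property* for a pair `(z, w)` (cycles not required to lie in `CR f`). -/
def PropertyStar' (f : X → X) (z w : X) : Prop :=
  ∃ r > 0, ∀ δ > 0, ∃ k > 0, ∃ c c' : ℕ → X,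
    IsChain' f δ c k ∧ IsChain' f δ c' k ∧
    c 0 = z ∧ c k = z ∧ c' 0 = w ∧ c' k = w ∧
    ∀ i ≤ k, dist (c i) (c' i) > r

/-- Omega-limit set of the point `(x, y)` under `f × f`. -/
def OmegaLimit2 (f : X → X) (x y : X) : Set (X × X) :=
  {p | ∃ φ : ℕ → ℕ, StrictMono φ ∧
    Tendsto (fun n => (f^[φ n] x, f^[φ n] y)) atTop (nhds p)}

/-- Omega-limit set of a point under `f`. -/
def OmegaLimit1 (f : X → X) (x : X) : Set X :=
  {p | ∃ φ : ℕ → ℕ, StrictMono φ ∧ Tendsto (fun n => f^[φ n] x) atTop (nhds p)}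

/-- `(x, y)` is a DC1-pair for `f`. -/
def DC1Pair (f : X → X) (x y : X) : Prop :=
  (∀ δ > 0, Filter.limsup (fun n : ℕ =>
      (((Finset.range n).filter fun i => dist (f^[i] x) (f^[i] y) < δ).card : ℝ) / n)
      Filter.atTop = 1) ∧
  (∃ δ₀ > 0, Filter.limsup (fun n : ℕ =>
      (((Finset.range n).filter fun i => dist (f^[i] x) (f^[i] y) > δ₀).card : ℝ) / n)
      Filter.atTop = 1)

/-- `f` exhibits distributional chaos of type 1. -/
def ExhibitsDC1 (f : X → X) : Prop :=
  ∃ S : Set X, ¬ S.Countable ∧ ∀ x ∈ S, ∀ y ∈ S, x ≠ y → DC1Pair f x y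

/-- `(x, y)` is a Li-Yorke pair for `f`. -/
def LiYorkePair (f : X → X) (x y : X) : Prop :=
  Filter.liminf (fun n => dist (f^[n] x) (f^[n] y)) Filter.atTop = 0 ∧
  Filter.limsup (fun n => dist (f^[n] x) (f^[n] y)) Filter.atTop > 0

/-- `(x, y)` is a proximal pair for `f`. -/
def ProximalPair (f : X → X) (x y : X) : Prop :=
  Filter.liminf (fun n => dist (f^[n] x) (f^[n] y)) Filter.atTop = 0

/-- `(x, y)` is a distal pair for `f`. -/
def DistalPair (f : X → X) (x y : X) : Prop :=
  0 < ⨅ n : ℕ, dist (f^[n] x) (f^[n] y)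

/-- `f` has the limit shadowing property. -/
def LimitShadowing (f : X → X) : Prop :=
  ∀ x : ℕ → X, Tendsto (fun i => dist (f (x i)) (x (i + 1))) atTop (nhds 0) →
    ∃ p : X, Tendsto (fun i => dist (f^[i] p) (x i)) atTop (nhds 0)

/-- The restriction of `f` to `CR f` has the shadowing property. -/
def ShadowingOnCR (f : X → X) : Prop :=
  ∀ ε > 0, ∃ δ > 0, ∀ x : ℕ → X, (∀ i, x i ∈ CR f) →
    (∀ i, dist (f (x i)) (x (i + 1)) ≤ δ) →
    ∃ p ∈ CR f, ∀ i, dist (f^[i] p) (x i) ≤ ε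

/-- Topological entropy of `f` relative to the cover `U`. -/
noncomputable def entropyOfCover (f : X → X) {ι : Type*} (U : ι → Set X) : ℝ :=
  Filter.limsup (fun n : ℕ =>
    Real.log ((sInf {m : ℕ | ∃ s : Finset (Fin n → ι), s.card = m ∧
      (⋃ g ∈ s, ⋂ i : Fin n, f^[(i : ℕ)] ⁻¹' U (g i)) = Set.univ} : ℕ) : ℝ) / n)
    Filter.atTop

/-- `(x, y)` is an entropy pair for `f`. -/
def EntropyPair (f : X → X) (x y : X) : Prop :=
  x ≠ y ∧ ∀ A B : Set X, IsClosed A → IsClosed B → x ∈ interior A → y ∈ interior B →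
    Disjoint A B → 0 < entropyOfCover f (fun b : Bool => if b then Aᶜ else Bᶜ)

end Defs

section Aux

variable {X : Type*} [MetricSpace X]

/-- `y` can be reached from `x` by a `δ`-chain of length `k` inside `A`. -/
def Rch (f : X → X) (A : Set X) (δ : ℝ) : ℕ → X → X → Prop
  | 0, x, y => x = y ∧ x ∈ A
  | k + 1, x, y => ∃ z, Rch f A δ k x z ∧ dist (f z) y ≤ δ ∧ y ∈ A

theorem rch_iff (f : X → X) (A : Set X) (δ : ℝ) (k : ℕ) (x y : X) :
    Rch f A δ k x y ↔ ∃ c : ℕ → X, IsChain' f δ c k ∧ (∀ i ≤ k, c i ∈ A) ∧ c 0 = x ∧ c k = y := by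
  induction k generalizing y with
  | zero =>
    constructor
    · rintro ⟨rfl, hx⟩
      exact ⟨fun _ => x, fun i hi => absurd hi (by omega), fun _ _ => hx, rfl, rfl⟩
    · rintro ⟨c, -, h2, rfl, rfl⟩
      exact ⟨rfl, h2 0 le_rfl⟩
  | succ k ih =>
    constructor
    · rintro ⟨z, hz, hd, hy⟩
      obtain ⟨c, h1, h2, h3, h4⟩ := (ih z).1 hz
      refine ⟨fun i => if i ≤ k then c i else y, ?_, ?_, ?_, ?_⟩
      · intro i hi
        rcases Nat.lt_or_ge i k with h | h
        · simp only [if_pos h.le, if_pos (show i + 1 ≤ k from h)]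
          exact h1 i h
        · have : i = k := by omega
          subst this
          simp only [le_refl, if_true, if_neg (show ¬ (i + 1 ≤ i) by omega), h4]
          exact hd
      · intro i hi
        by_cases h : i ≤ k
        · simp only [if_pos h]; exact h2 i h
        · simp only [if_neg h]; exact hy
      · simp [h3]
      · simp
    · rintro ⟨c, h1, h2, h3, h4⟩
      refine ⟨c k, (ih _).2 ⟨c, fun i hi => h1 i (by omega), fun i hi => h2 i (by omega), h3, rfl⟩,
        ?_, ?_⟩
      · rw [← h4]; exact h1 k (by omega)
      · rw [← h4]; exact h2 _ le_rfl

theorem Rch.trans {f : X → X} {A : Set X} {δ : ℝ} {a b : ℕ} {x y z : X}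
    (h1 : Rch f A δ a x y) (h2 : Rch f A δ b y z) : Rch f A δ (a + b) x z := by
  induction b generalizing z with
  | zero => obtain ⟨rfl, -⟩ := h2; exact h1
  | succ b ih =>
    obtain ⟨w, hw, hd, hz⟩ := h2
    exact ⟨w, ih hw, hd, hz⟩

theorem Rch.mem_right {f : X → X} {A : Set X} {δ : ℝ} {a : ℕ} {x y : X}
    (h1 : Rch f A δ a x y) : y ∈ A := by
  cases a with
  | zero => obtain ⟨rfl, h⟩ := h1; exact h
  | succ b => obtain ⟨w, hw, hd, hz⟩ := h1; exact hz

theorem Rch.cycle {f : X → X} {A : Set X} {δ : ℝ} {a : ℕ} {x : X}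
    (h1 : Rch f A δ a x x) (n : ℕ) : Rch f A δ (a * n) x x := by
  induction n with
  | zero => exact ⟨rfl, h1.mem_right⟩
  | succ n ih => exact ih.trans h1

theorem Rch.mono {f : X → X} {A : Set X} {δ δ' : ℝ} (hδ : δ ≤ δ') {a : ℕ} {x y : X}
    (h1 : Rch f A δ a x y) : Rch f A δ' a x y := by
  induction a generalizing y with
  | zero => exact h1
  | succ a ih => obtain ⟨w, hw, hd, hz⟩ := h1; exact ⟨w, ih hw, hd.trans hδ, hz⟩

/-- change the end point -/
theorem Rch.end_change {f : X → X} {A : Set X} {δ δ' : ℝ} (hδ : δ ≤ δ') {a : ℕ} {x y y' : X}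
    (ha : 0 < a) (h1 : Rch f A δ a x y) (hy : dist y y' + δ ≤ δ') (hy' : y' ∈ A) :
    Rch f A δ' a x y' := by
  obtain ⟨b, rfl⟩ := Nat.exists_eq_succ_of_ne_zero ha.ne'
  obtain ⟨w, hw, hd, hz⟩ := h1
  refine ⟨w, hw.mono hδ, ?_, hy'⟩
  have := dist_triangle (f w) y y'
  linarith

/-- first step -/
theorem Rch.first {f : X → X} {A : Set X} {δ : ℝ} {a : ℕ} {x y : X}
    (h1 : Rch f A δ (a + 1) x y) : ∃ z ∈ A, x ∈ A ∧ dist (f x) z ≤ δ ∧ Rch f A δ a z y := by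
  induction a generalizing y with
  | zero =>
    obtain ⟨w, ⟨rfl, hx⟩, hd, hz⟩ := h1
    exact ⟨y, hz, hx, hd, rfl, hz⟩
  | succ a ih =>
    obtain ⟨w, hw, hd, hz⟩ := h1
    obtain ⟨z, hzA, hx, hdz, hr⟩ := ih hw
    exact ⟨z, hzA, hx, hdz, w, hr, hd, hz⟩

/-- change the starting point -/
theorem Rch.start_change {f : X → X} {A : Set X} {δ δ' : ℝ} (hδ : δ ≤ δ') {a : ℕ} {x x' y : X}
    (ha : 0 < a) (h1 : Rch f A δ a x y) (hx : dist (f x) (f x') + δ ≤ δ') (hx' : x' ∈ A) :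
    Rch f A δ' a x' y := by
  obtain ⟨b, rfl⟩ := Nat.exists_eq_succ_of_ne_zero ha.ne'
  obtain ⟨z, hzA, hx, hdz, hr⟩ := h1.first
  have h0 : Rch f A δ' 1 x' z := by
    refine ⟨x', ⟨rfl, hx'⟩, ?_, hzA⟩
    have := dist_triangle_left (f x') z (f x)
    linarith
  have := h0.trans (hr.mono hδ)
  rwa [Nat.add_comm] at this

theorem mem_CR_iff (f : X → X) (x : X) :
    x ∈ CR f ↔ ∀ δ > 0, ∃ k > 0, Rch f Set.univ δ k x x := by
  simp [CR, rch_iff]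

theorem exists_modulus [CompactSpace X] {f : X → X} (hf : Continuous f) {ε : ℝ} (hε : 0 < ε) :
    ∃ δ > 0, δ ≤ ε ∧ ∀ x y, dist x y ≤ δ → dist (f x) (f y) ≤ ε := by
  obtain ⟨δ, hδ, h⟩ := Metric.uniformContinuous_iff.1
    (CompactSpace.uniformContinuous_of_continuous hf) ε hε
  refine ⟨min (δ / 2) ε, by positivity, min_le_right _ _, fun x y hxy => (h ?_).le⟩
  have := min_le_left (δ / 2) ε
  linarith

/-- almost chain recurrent points are near `CR f` -/
theorem near_CR [CompactSpace X] {f : X → X} (hf : Continuous f) {η : ℝ} (hη : 0 < η) :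
    ∃ δ > 0, ∀ x k, 0 < k → Rch f Set.univ δ k x x → ∃ z ∈ CR f, dist x z < η := by
  by_contra! hcon
  have h1 : ∀ n : ℕ, ∃ x, ∃ k > 0, Rch f Set.univ (1 / ((n : ℝ) + 1)) k x x ∧
      ∀ z ∈ CR f, η ≤ dist x z := by
    intro n
    obtain ⟨x, k, hk, h, h'⟩ := hcon (1 / ((n : ℝ) + 1)) (by positivity)
    exact ⟨x, k, hk, h, h'⟩
  choose x k hk hx hz using h1
  obtain ⟨p, -, φ, hφ, hlim⟩ := isCompact_univ.tendsto_subseq (fun n => Set.mem_univ (x n))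
  have hp : p ∈ CR f := by
    rw [mem_CR_iff]
    intro δ hδ
    obtain ⟨ω, hω, hωδ, hm⟩ := exists_modulus hf (show (0 : ℝ) < δ / 3 by positivity)
    have e1 : ∀ᶠ n in atTop, dist (x (φ n)) p < ω := Metric.tendsto_nhds.1 hlim ω hω
    have e2 : ∀ᶠ n in atTop, 1 / ((φ n : ℝ) + 1) < δ / 3 :=
      (tendsto_one_div_add_atTop_nhds_zero_nat.comp hφ.tendsto_atTop).eventually
        (gt_mem_nhds (by positivity))
    obtain ⟨n, h1, h2⟩ := (e1.and e2).exists
    refine ⟨k (φ n), hk _, ?_⟩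
    have r1 := (hx (φ n)).mono h2.le
    have r2 := r1.end_change (δ' := 2 * (δ / 3)) (by linarith) (hk _) (y' := p)
      (by linarith) (Set.mem_univ _)
    exact r2.start_change (by linarith) (hk _) (by linarith [hm _ _ h1.le]) (Set.mem_univ _)
  obtain ⟨n, hn⟩ := (Metric.tendsto_nhds.1 hlim η hη).exists
  exact absurd hn (not_lt.2 (hz _ _ hp))

/-- `CR f` is chain recurrent in itself -/
theorem CR_internal [CompactSpace X] {f : X → X} (hf : Continuous f) {x : X} (hx : x ∈ CR f)
    {δ : ℝ} (hδ : 0 < δ) : ∃ k > 0, Rch f (CR f) δ k x x := by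
  obtain ⟨ω, hω, hωδ, hm⟩ := exists_modulus hf (show (0 : ℝ) < δ / 3 by positivity)
  obtain ⟨δ', hδ', hn⟩ := near_CR hf hω
  obtain ⟨k, hk, hr⟩ := (mem_CR_iff f x).1 hx (min δ' (δ / 3)) (by positivity)
  refine ⟨k, hk, ?_⟩
  obtain ⟨c, h1, -, h3, h4⟩ := (rch_iff _ _ _ _ _ _).1 hr
  have key : ∀ i ≤ k, ∃ z ∈ CR f, dist (c i) z < ω := by
    intro i hi
    have a1 : Rch f Set.univ (min δ' (δ / 3)) i x (c i) :=
      (rch_iff _ _ _ _ _ _).2 ⟨c, fun j hj => h1 j (by omega), fun _ _ => Set.mem_univ _, h3, rfl⟩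
    have a2 : Rch f Set.univ (min δ' (δ / 3)) (k - i) (c i) x :=
      (rch_iff _ _ _ _ _ _).2 ⟨fun j => c (i + j), fun j hj => h1 (i + j) (by omega),
        fun _ _ => Set.mem_univ _, rfl, by simp [hi, h4]⟩
    have a3 := (a2.trans a1).mono (min_le_left _ _)
    exact hn _ _ (by omega) a3
  have : Nonempty X := ⟨x⟩
  choose! g hg hgd using key
  refine (rch_iff _ _ _ _ _ _).2 ⟨fun i => if i = 0 ∨ i = k then x else g i, ?_, ?_, ?_, ?_⟩
  · have hclose : ∀ i ≤ k, dist (c i) (if i = 0 ∨ i = k then x else g i) ≤ ω := by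
      intro i hi
      split_ifs with h
      · rcases h with rfl | rfl
        · simp [h3, hω.le]
        · simp [h4, hω.le]
      · exact (hgd i hi).le
    intro i hi
    have b1 := hm _ _ (hclose i hi.le)
    have b2 := hclose (i + 1) hi
    have b3 := h1 i hi
    have b4 := min_le_right δ' (δ / 3)
    have b5 := dist_triangle_left (f (if i = 0 ∨ i = k then x else g i)) (c (i + 1)) (f (c i))
    have b6 := dist_triangle (f (if i = 0 ∨ i = k then x else g i)) (c (i + 1))
      (if i + 1 = 0 ∨ i + 1 = k then x else g (i + 1))
    show dist (f (if i = 0 ∨ i = k then x else g i))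
      (if i + 1 = 0 ∨ i + 1 = k then x else g (i + 1)) ≤ δ
    linarith
  · intro i hi
    dsimp only
    split_ifs
    · exact hx
    · exact hg i hi
  · simp
  · simp

/-- the `δ`-version of the chain relation -/
def RR (f : X → X) (δ : ℝ) (x y : X) : Prop :=
  ∃ m > 0, ∃ N > 0, ∀ n ≥ N, Rch f (CR f) δ (m * n) x y ∧ Rch f (CR f) δ (m * n) y x

theorem chainRel_iff (f : X → X) (x y : X) : ChainRel f x y ↔ ∀ δ > 0, RR f δ x y := by
  simp [ChainRel, RR, rch_iff]

theorem RR.symm {f : X → X} {δ : ℝ} {x y : X} (h : RR f δ x y) : RR f δ y x := by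
  obtain ⟨m, hm, N, hN, h⟩ := h
  exact ⟨m, hm, N, hN, fun n hn => (h n hn).symm⟩

theorem RR.mono {f : X → X} {δ δ' : ℝ} (hδ : δ ≤ δ') {x y : X} (h : RR f δ x y) :
    RR f δ' x y := by
  obtain ⟨m, hm, N, hN, h⟩ := h
  exact ⟨m, hm, N, hN, fun n hn => ⟨(h n hn).1.mono hδ, (h n hn).2.mono hδ⟩⟩

theorem RR.trans {f : X → X} {δ : ℝ} {x y z : X} (h : RR f δ x y) (h' : RR f δ y z) :
    RR f δ x z := by
  obtain ⟨m, hm, N, hN, h⟩ := h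
  obtain ⟨m', hm', N', hN', h'⟩ := h'
  refine ⟨m * m', Nat.mul_pos hm hm', N + N', by omega, fun n hn => ?_⟩
  obtain ⟨b, rfl⟩ : ∃ b, n = N + b := ⟨n - N, by omega⟩
  have hb : N' ≤ b := by omega
  have g1 := h (m' * N) (Nat.le_mul_of_pos_left _ hm')
  have g2 := h' (m * b) (hb.trans (Nat.le_mul_of_pos_left _ hm))
  have e : m * m' * (N + b) = m * (m' * N) + m' * (m * b) := by ring
  refine ⟨e ▸ g1.1.trans g2.1, ?_⟩
  rw [e, Nat.add_comm]
  exact g2.2.trans g1.2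

theorem RR.of_close [CompactSpace X] {f : X → X} (hf : Continuous f) {δ : ℝ} (hδ : 0 < δ) {x y : X}
    (hx : x ∈ CR f) (hy : y ∈ CR f) (hxy : dist x y ≤ δ / 2) : RR f δ x y := by
  obtain ⟨k, hk, h1⟩ := CR_internal hf hx (half_pos hδ)
  obtain ⟨l, hl, h2⟩ := CR_internal hf hy (half_pos hδ)
  have c1 : Rch f (CR f) δ k x y := h1.end_change (by linarith) hk (by linarith) hy
  have c2 : Rch f (CR f) δ l y x :=
    h2.end_change (by linarith) hl (by rw [dist_comm]; linarith) hx
  have h1' := h1.mono (show δ / 2 ≤ δ by linarith)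
  have h2' := h2.mono (show δ / 2 ≤ δ by linarith)
  refine ⟨k * l, Nat.mul_pos hk hl, 1, one_pos, fun n hn => ⟨?_, ?_⟩⟩
  · have hp : 0 < l * n := Nat.mul_pos hl hn
    obtain ⟨t, ht⟩ := Nat.exists_eq_succ_of_ne_zero hp.ne'
    have := (h1'.cycle t).trans c1
    rw [Nat.mul_assoc, ht, Nat.mul_succ]
    exact this
  · have hp : 0 < k * n := Nat.mul_pos hk hn
    obtain ⟨t, ht⟩ := Nat.exists_eq_succ_of_ne_zero hp.ne'
    have := (h2'.cycle t).trans c2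
    rw [Nat.mul_comm k l, Nat.mul_assoc, ht, Nat.mul_succ]
    exact this

theorem CR_mapsTo [CompactSpace X] {f : X → X} (hf : Continuous f) {x : X} (hx : x ∈ CR f) :
    f x ∈ CR f := by
  rw [mem_CR_iff]
  intro δ hδ
  obtain ⟨ω, hω, hωδ, hm⟩ := exists_modulus hf (show (0 : ℝ) < δ / 2 by positivity)
  obtain ⟨k, hk, h1⟩ := (mem_CR_iff f x).1 hx ω hω
  have h2 := h1.cycle 2
  obtain ⟨t, ht⟩ : ∃ t, k * 2 = (t + 1) + 1 := ⟨k * 2 - 2, by omega⟩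
  rw [ht] at h2
  obtain ⟨z, -, -, hd, hr⟩ := h2.first
  have h3 : Rch f Set.univ δ (t + 1) (f x) x := hr.start_change (by linarith) (by omega)
    (by rw [dist_comm] at hd; linarith [hm _ _ hd]) (Set.mem_univ _)
  exact ⟨t + 1 + 1, by omega, x, h3, by simp [hδ.le], Set.mem_univ _⟩

/-- from `f x` one can go back to `x` -/
theorem back [CompactSpace X] {f : X → X} (hf : Continuous f) {x : X} (hx : x ∈ CR f)
    {δ : ℝ} (hδ : 0 < δ) : ∃ t, Rch f (CR f) δ t (f x) x := by
  obtain ⟨ω, hω, hωδ, hm⟩ := exists_modulus hf (show (0 : ℝ) < δ / 2 by positivity)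
  obtain ⟨k, hk, h1⟩ := CR_internal hf hx hω
  have h2 := h1.cycle 2
  obtain ⟨t, ht⟩ : ∃ t, k * 2 = (t + 1) + 1 := ⟨k * 2 - 2, by omega⟩
  rw [ht] at h2
  obtain ⟨z, -, -, hd, hr⟩ := h2.first
  exact ⟨t + 1, hr.start_change (by linarith) (by omega)
    (by rw [dist_comm] at hd; linarith [hm _ _ hd]) (CR_mapsTo hf hx)⟩

theorem RR.map [CompactSpace X] {f : X → X} (hf : Continuous f) {δ : ℝ} (hδ : 0 < δ) {x y : X}
    (hx : x ∈ CR f) (hy : y ∈ CR f) (h : RR f δ x y) : RR f δ (f x) (f y) := by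
  obtain ⟨m, hm, N, hN, h⟩ := h
  obtain ⟨s, hs⟩ := back hf hx hδ
  obtain ⟨t, ht⟩ := back hf hy hδ
  have ex : Rch f (CR f) δ 1 x (f x) := ⟨x, ⟨rfl, hx⟩, by simp [hδ.le], CR_mapsTo hf hx⟩
  have ey : Rch f (CR f) δ 1 y (f y) := ⟨y, ⟨rfl, hy⟩, by simp [hδ.le], CR_mapsTo hf hy⟩
  have go : ∀ x y s, Rch f (CR f) δ s (f x) x → Rch f (CR f) δ 1 x (f x) →
      Rch f (CR f) δ 1 y (f y) → (∀ n ≥ N, Rch f (CR f) δ (m * n) x y) →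
      ∀ n ≥ N + s + 1, Rch f (CR f) δ (m * n) (f x) (f y) := by
    intro x y s hs ex ey h n hn
    obtain ⟨b, rfl⟩ : ∃ b, n = (s + 1) + b := ⟨n - (s + 1), by omega⟩
    obtain ⟨m', rfl⟩ := Nat.exists_eq_succ_of_ne_zero hm.ne'
    have := (((hs.trans ((ex.trans hs).cycle m')).trans (h b (by omega))).trans ey)
    have e : (m' + 1) * (s + 1 + b) = s + (1 + s) * m' + (m' + 1) * b + 1 := by ring
    rw [Nat.succ_eq_add_one, e]
    exact this
  refine ⟨m, hm, N + s + t + 1, by omega, fun n hn => ⟨?_, ?_⟩⟩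
  · exact go x y s hs ex ey (fun n hn => (h n hn).1) n (by omega)
  · exact go y x t ht ey ex (fun n hn => (h n hn).2) n (by omega)

/-- classes become small when `~` is trivial -/
theorem small_classes [CompactSpace X] {f : X → X} (hf : Continuous f)
    (htriv : ∀ x y, x ∈ CR f → y ∈ CR f → ChainRel f x y → x = y) {ε : ℝ} (hε : 0 < ε) :
    ∃ δ > 0, ∀ x y, x ∈ CR f → y ∈ CR f → RR f δ x y → dist x y < ε := by
  by_contra! hcon
  have h1 : ∀ n : ℕ, ∃ p : X × X, p.1 ∈ CR f ∧ p.2 ∈ CR f ∧ RR f (1 / ((n : ℝ) + 1)) p.1 p.2 ∧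
      ε ≤ dist p.1 p.2 := by
    intro n
    obtain ⟨x, y, h⟩ := hcon (1 / ((n : ℝ) + 1)) (by positivity)
    exact ⟨(x, y), h⟩
  choose p hp1 hp2 hr hd using h1
  obtain ⟨q, -, φ, hφ, hlim⟩ := isCompact_univ.tendsto_subseq (fun n => Set.mem_univ (p n))
  have hclosed : IsClosed (CR f) := by
    refine isClosed_of_closure_subset fun x hx => ?_
    rw [mem_CR_iff]
    intro δ hδ
    obtain ⟨ω, hω, hωδ, hm⟩ := exists_modulus hf (show (0 : ℝ) < δ / 3 by positivity)
    obtain ⟨z, hz, hxz⟩ := Metric.mem_closure_iff.1 hx ω hω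
    obtain ⟨k, hk, h⟩ := (mem_CR_iff f z).1 hz (δ / 3) (by positivity)
    rw [dist_comm] at hxz
    refine ⟨k, hk, ?_⟩
    have r2 := h.end_change (δ' := 2 * (δ / 3)) (by linarith) hk (y' := x)
      (by linarith) (Set.mem_univ _)
    exact r2.start_change (by linarith) hk (by linarith [hm _ _ hxz.le]) (Set.mem_univ _)
  have l1 : Tendsto (fun n => (p (φ n)).1) atTop (nhds q.1) :=
    (continuous_fst.tendsto q).comp hlim
  have l2 : Tendsto (fun n => (p (φ n)).2) atTop (nhds q.2) :=
    (continuous_snd.tendsto q).comp hlim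
  have q1 : q.1 ∈ CR f := hclosed.mem_of_tendsto l1 (Eventually.of_forall fun n => hp1 _)
  have q2 : q.2 ∈ CR f := hclosed.mem_of_tendsto l2 (Eventually.of_forall fun n => hp2 _)
  have heq : q.1 = q.2 := by
    refine htriv _ _ q1 q2 ((chainRel_iff _ _ _).2 fun δ hδ => ?_)
    have e1 := Metric.tendsto_nhds.1 l1 (δ / 2) (half_pos hδ)
    have e2 := Metric.tendsto_nhds.1 l2 (δ / 2) (half_pos hδ)
    have e3 : ∀ᶠ n in atTop, 1 / ((φ n : ℝ) + 1) < δ :=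
      (tendsto_one_div_add_atTop_nhds_zero_nat.comp hφ.tendsto_atTop).eventually
        (gt_mem_nhds hδ)
    obtain ⟨n, ⟨a1, a2⟩, a3⟩ := ((e1.and e2).and e3).exists
    have b1 := RR.of_close hf hδ (hp1 (φ n)) q1 a1.le
    have b2 := RR.of_close hf hδ (hp2 (φ n)) q2 a2.le
    exact (b1.symm.trans ((hr (φ n)).mono a3.le)).trans b2
  have l3 : Tendsto (fun n => dist (p (φ n)).1 (p (φ n)).2) atTop (nhds (dist q.1 q.2)) :=
    l1.dist l2
  have := ge_of_tendsto' l3 (fun n => hd (φ n))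
  rw [heq, dist_self] at this
  linarith

open Dynamics in
/-- a family of points coded by few symbols gives a small dynamical cover -/
theorem cover_of_code {X C : Type*} (f : X → X) (U : SetRel X X) (n : ℕ) (B : Finset C) (D : X → C)
    (hD : ∀ x, D x ∈ B)
    (h : ∀ x y, D x = D y → ∀ i < n, (f^[i] x, f^[i] y) ∈ U) :
    coverMincard f Set.univ U n ≤ B.card := by
  rcases isEmpty_or_nonempty X with hX | hX
  · have : (Set.univ : Set X) = ∅ := Set.univ_eq_empty_iff.2 hX
    rw [this, coverMincard_empty]
    exact zero_le
  · let g : C → X := Function.invFun D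
    have hg : ∀ x, D (g (D x)) = D x := fun x => Function.invFun_eq ⟨x, rfl⟩
    have hc : IsDynCoverOf f Set.univ U n (B.image g : Finset X) := by
      intro x _
      refine ⟨g (D x), ?_, ?_⟩
      · exact Finset.mem_coe.2 (Finset.mem_image_of_mem _ (hD x))
      · exact mem_dynEntourage.2 (h x _ (hg x).symm)
    refine hc.coverMincard_le_card.trans ?_
    exact_mod_cast Finset.card_image_le

theorem card_small_subsets {C : Type*} (B : Finset C) (K : ℕ) :
    (B.powerset.filter (fun s => s.card ≤ K)).card ≤ (K + 1) * (B.card + 1) ^ K := by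
  have hsub : B.powerset.filter (fun s => s.card ≤ K) ⊆
      (Finset.range (K + 1)).biUnion (fun j => B.powersetCard j) := by
    intro s hs
    simp only [Finset.mem_filter, Finset.mem_powerset] at hs
    simp only [Finset.mem_biUnion, Finset.mem_range, Finset.mem_powersetCard]
    exact ⟨s.card, by omega, hs.1, rfl⟩
  refine (Finset.card_le_card hsub).trans (Finset.card_biUnion_le.trans ?_)
  calc ∑ j ∈ Finset.range (K + 1), (B.powersetCard j).card
      ≤ ∑ j ∈ Finset.range (K + 1), (B.card + 1) ^ K := by
        refine Finset.sum_le_sum fun j hj => ?_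
        rw [Finset.card_powersetCard]
        refine (Nat.choose_le_pow B.card j).trans ?_
        refine (Nat.pow_le_pow_left (Nat.le_succ _) j).trans ?_
        exact Nat.pow_le_pow_right (Nat.succ_pos _) (by simpa [Nat.lt_succ_iff] using hj)
    _ = _ := by simp

open ExpGrowth in
theorem expGrowth_poly (u : ℕ → ENNReal) (c q K : ℕ)
    (hu : ∀ n, u n ≤ ((c * (n * q + 1) ^ K : ℕ) : ENNReal)) : expGrowthSup u ≤ 0 := by
  by_contra! hpos
  obtain ⟨a, ha0, ha1⟩ := EReal.lt_iff_exists_real_btwn.1 hpos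
  have ha : 0 < a := by exact_mod_cast ha0
  refine absurd ha1 (not_lt.2 ?_)
  refine Eventually.expGrowthSup_le ?_
  have h1 : ∀ᶠ n : ℕ in atTop, ((c * (n * q + 1) ^ K : ℕ) : ℝ) ≤ Real.exp (a * n) := by
    have l := ((isLittleO_pow_exp_pos_mul_atTop K ha).comp_tendsto
      (tendsto_natCast_atTop_atTop (R := ℝ))).bound
      (c := 1 / ((c : ℝ) * (q + 1) ^ K + 1)) (by positivity)
    filter_upwards [l, eventually_ge_atTop 1] with n hn hn1
    simp only [Function.comp, norm_pow, Real.norm_eq_abs, Real.abs_exp, Nat.abs_cast] at hn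
    have hn1' : (1 : ℝ) ≤ n := by exact_mod_cast hn1
    have hb : ((n : ℝ) * q + 1) ^ K ≤ (q + 1) ^ K * n ^ K := by
      rw [← mul_pow]
      gcongr
      nlinarith
    push_cast
    rw [div_mul_eq_mul_div, one_mul, le_div_iff₀ (by positivity)] at hn
    have hc : (0 : ℝ) ≤ c := Nat.cast_nonneg _
    have hnK : (0 : ℝ) ≤ (n : ℝ) ^ K := by positivity
    nlinarith [mul_le_mul_of_nonneg_left hb hc]
  filter_upwards [h1] with n hn
  refine (hu n).trans ?_
  have : ((a : EReal) * (n : EReal)) = ((a * n : ℝ) : EReal) := by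
    push_cast; rfl
  rw [this, EReal.exp_coe, ← ENNReal.ofReal_natCast]
  exact ENNReal.ofReal_le_ofReal hn

open Dynamics in
/-- the counting argument -/
theorem entropy_of_coding {X S : Type*} [Fintype S] (f : X → X) (U : SetRel X X) (α : X → S)
    (Out : Set S) (M : ℕ)
    (hU : ∀ x y, α x = α y → (x, y) ∈ U)
    (hdet : ∀ x y, α x = α y → α x ∉ Out → α (f x) ∉ Out → α (f y) ∉ Out → α (f x) = α (f y))
    (hM : ∀ x (O : Finset ℕ), (∀ i ∈ O, α (f^[i] x) ∈ Out) → O.card ≤ M) :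
    coverEntropyEntourage f Set.univ U ≤ 0 := by
  refine expGrowth_poly _ (2 * M + 1 + 1) (Fintype.card S) (2 * M + 1) fun n => ?_
  let D : X → Finset (ℕ × S) := fun x => (Finset.range n ×ˢ (Finset.univ : Finset S)).filter
    (fun p => α (f^[p.1] x) = p.2 ∧ (p.1 = 0 ∨ p.2 ∈ Out ∨ ∃ j, p.1 = j + 1 ∧ α (f^[j] x) ∈ Out))
  have memD : ∀ x i s, (i, s) ∈ D x ↔ i < n ∧ α (f^[i] x) = s ∧
      (i = 0 ∨ s ∈ Out ∨ ∃ j, i = j + 1 ∧ α (f^[j] x) ∈ Out) := by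
    intro x i s
    simp [D]
  have hcard : ∀ x, (D x).card ≤ 2 * M + 1 := by
    intro x
    let O := (Finset.range n).filter (fun i => α (f^[i] x) ∈ Out)
    have hO : O.card ≤ M := hM x O fun i hi => (Finset.mem_filter.1 hi).2
    have hsub : D x ⊆ ({0} ∪ (O ∪ O.image (· + 1))).image (fun i => (i, α (f^[i] x))) := by
      rintro ⟨i, s⟩ hp
      obtain ⟨hi, hs, hcase⟩ := (memD _ _ _).1 hp
      rw [Finset.mem_image]
      refine ⟨i, ?_, by rw [hs]⟩
      rcases hcase with h | h | ⟨j, rfl, hj⟩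
      · simp [h]
      · simp [O, hi, hs, h]
      · simp only [Finset.mem_union, Finset.mem_image]
        exact Or.inr (Or.inr ⟨j, by simp [O, hj]; omega, rfl⟩)
    have c1 := Finset.card_le_card hsub
    have c2 := c1.trans Finset.card_image_le
    have c3 := Finset.card_union_le ({0} : Finset ℕ) (O ∪ O.image (· + 1))
    have c4 := Finset.card_union_le O (O.image (· + 1))
    have c5 : (O.image (· + 1)).card ≤ O.card := Finset.card_image_le
    have c6 : ({0} : Finset ℕ).card = 1 := Finset.card_singleton _
    omega
  have hcov := cover_of_code f U n
    ((Finset.range n ×ˢ (Finset.univ : Finset S)).powerset.filter (fun s => s.card ≤ 2 * M + 1)) D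
    (fun x => Finset.mem_filter.2 ⟨Finset.mem_powerset.2 (Finset.filter_subset _ _), hcard x⟩) ?_
  · have := card_small_subsets (Finset.range n ×ˢ (Finset.univ : Finset S)) (2 * M + 1)
    rw [Finset.card_product, Finset.card_range, Finset.card_univ] at this
    have h2 := hcov.trans (Nat.cast_le.2 this)
    exact_mod_cast ENat.toENNReal_mono h2
  · intro x y hxy
    have key : ∀ i < n, α (f^[i] x) = α (f^[i] y) := by
      have tr : ∀ x y, D x = D y → ∀ i < n,
          (i = 0 ∨ α (f^[i] x) ∈ Out ∨ ∃ j, i = j + 1 ∧ α (f^[j] x) ∈ Out) →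
          α (f^[i] x) = α (f^[i] y) := by
        intro x y hxy i hi hc
        have := (memD x i _).2 ⟨hi, rfl, hc⟩
        rw [hxy, memD] at this
        exact this.2.1.symm
      intro i
      induction i with
      | zero => intro hi; exact tr x y hxy 0 hi (Or.inl rfl)
      | succ i ih =>
        intro hi
        have e := ih (by omega)
        by_cases h1 : α (f^[i] x) ∈ Out
        · exact tr x y hxy _ hi (Or.inr (Or.inr ⟨i, rfl, h1⟩))
        by_cases h2 : α (f^[i + 1] x) ∈ Out
        · exact tr x y hxy _ hi (Or.inr (Or.inl h2))
        by_cases h3 : α (f^[i + 1] y) ∈ Out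
        · exact (tr y x hxy.symm _ hi (Or.inr (Or.inl h3))).symm
        rw [Function.iterate_succ_apply'] at h2 h3 ⊢
        rw [Function.iterate_succ_apply']
        exact hdet _ _ e h1 h2 h3
    exact fun i hi => hU _ _ (key i hi)

open Dynamics in
theorem entropy_zero [CompactSpace X] {f : X → X} (hf : Continuous f)
    (htriv : ∀ x y, x ∈ CR f → y ∈ CR f → ChainRel f x y → x = y) :
    coverEntropy f Set.univ ≤ 0 := by
  rw [coverEntropy_eq_iSup_basis Metric.uniformity_basis_dist]
  refine iSup₂_le fun ε hε => ?_
  obtain ⟨δ, hδ, hsmall⟩ := small_classes hf htriv (show (0 : ℝ) < ε / 3 by positivity)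
  obtain ⟨ω, hω, hωδ, hm⟩ := exists_modulus hf (show (0 : ℝ) < δ / 4 by positivity)
  obtain ⟨η, hη, hηω, hηε⟩ : ∃ η > 0, η ≤ ω ∧ η ≤ ε / 3 :=
    ⟨min ω (ε / 3), by positivity, min_le_left _ _, min_le_right _ _⟩
  obtain ⟨δ', hδ', hnear⟩ := near_CR hf hη
  -- finite nets
  have net : ∀ r : ℝ, 0 < r → ∃ (t : Finset X) (g : X → t), ∀ x : X, dist x (g x : X) < r := by
    intro r hr
    obtain ⟨t, htf, ht⟩ := Metric.totallyBounded_iff.1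
      (isCompact_univ (X := X)).totallyBounded r hr
    have : ∀ x, ∃ y : htf.toFinset, dist x (y : X) < r := by
      intro x
      have := ht (Set.mem_univ x)
      simp only [Set.mem_iUnion, Metric.mem_ball] at this
      obtain ⟨y, hy, hd⟩ := this
      exact ⟨⟨y, by simpa using hy⟩, hd⟩
    choose g hg using this
    exact ⟨htf.toFinset, g, hg⟩
  obtain ⟨t, g, hg⟩ := net (min (δ' / 2) (ε / 2)) (by positivity)
  obtain ⟨t₂, g₂, hg₂⟩ := net (δ / 4) (by positivity)
  -- classes
  let st : Setoid (CR f) :=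
    { r := fun a b => RR f δ a b
      iseqv := ⟨fun a => RR.of_close hf hδ a.2 a.2 (by rw [dist_self]; positivity), fun h => h.symm,
        fun h h' => h.trans h'⟩ }
  have hfin : Finite (Quotient st) := by
    refine Finite.of_injective (fun q : Quotient st => g₂ (q.out : CR f)) fun p q hpq => ?_
    have h1 := hg₂ (p.out : CR f)
    have h2 := hg₂ (q.out : CR f)
    dsimp only at hpq
    rw [← hpq] at h2
    have h3 := dist_triangle_right ((p.out : CR f) : X) ((q.out : CR f) : X)
      (g₂ (p.out : CR f) : X)
    have : RR f δ (p.out : CR f) (q.out : CR f) :=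
      RR.of_close hf hδ p.out.2 q.out.2 (by linarith)
    rw [← Quotient.out_eq p, ← Quotient.out_eq q]
    exact Quotient.sound this
  have : Fintype (Quotient st) := Fintype.ofFinite _
  let α : X → Quotient st ⊕ t := fun x =>
    if h : ∃ z : CR f, dist x z < η then Sum.inl (Quotient.mk st h.choose) else Sum.inr (g x)
  let Out : Set (Quotient st ⊕ t) := Set.range Sum.inr
  have αout : ∀ x, α x ∈ Out → (¬ ∃ z : CR f, dist x z < η) ∧ α x = Sum.inr (g x) := by
    intro x hx
    by_cases h : ∃ z : CR f, dist x z < η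
    · obtain ⟨s, hs⟩ := hx
      simp only [α, dif_pos h] at hs
      cases hs
    · exact ⟨h, by simp only [α, dif_neg h]⟩
  have αin : ∀ x, α x ∉ Out → ∃ z : CR f, dist x z < η ∧ α x = Sum.inl (Quotient.mk st z) := by
    intro x hx
    by_cases h : ∃ z : CR f, dist x z < η
    · exact ⟨h.choose, h.choose_spec, by simp only [α, dif_pos h]⟩
    · exact absurd ⟨g x, by simp only [α, dif_neg h]⟩ hx
  have rel : ∀ a b : CR f, (Sum.inl (Quotient.mk st a) : Quotient st ⊕ t) =
      Sum.inl (Quotient.mk st b) → RR f δ a b := by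
    intro a b hab
    exact Quotient.exact (Sum.inl.inj hab)
  refine entropy_of_coding f _ α Out (Fintype.card t) ?_ ?_ ?_
  · intro x y hxy
    show dist x y < ε
    by_cases hx : α x ∈ Out
    · obtain ⟨-, h1⟩ := αout x hx
      obtain ⟨-, h2⟩ := αout y (hxy ▸ hx)
      have h3 : g x = g y := Sum.inr.inj (h1.symm.trans (hxy.trans h2))
      have h4 := hg x
      have h5 := hg y
      rw [← h3] at h5
      have h6 := dist_triangle_right x y (g x : X)
      have h7 := min_le_right (δ' / 2) (ε / 2)
      linarith
    · obtain ⟨a, ha, h1⟩ := αin x hx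
      obtain ⟨b, hb, h2⟩ := αin y (hxy ▸ hx)
      have h3 := rel a b (h1.symm.trans (hxy.trans h2))
      have h4 := hsmall _ _ a.2 b.2 h3
      have h5 := dist_triangle4_right x y (a : X) (b : X)
      linarith
  · intro x y hxy hx hfx hfy
    obtain ⟨a, ha, h1⟩ := αin x hx
    obtain ⟨b, hb, h2⟩ := αin y (hxy ▸ hx)
    obtain ⟨a', ha', h1'⟩ := αin _ hfx
    obtain ⟨b', hb', h2'⟩ := αin _ hfy
    have h3 := rel a b (h1.symm.trans (hxy.trans h2))
    have h4 := RR.map hf hδ a.2 b.2 h3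
    have step : ∀ (x : X) (a a' : CR f), dist x a < η → dist (f x) a' < η →
        RR f δ (f a) a' := by
      intro x a a' h h'
      refine RR.of_close hf hδ (CR_mapsTo hf a.2) a'.2 ?_
      have e1 := hm x a (by linarith)
      have e2 := dist_triangle_left (f a) (a' : X) (f x)
      linarith
    have h5 : RR f δ a' b' := ((step x a a' ha ha').symm.trans h4).trans (step y b b' hb hb')
    rw [h1', h2']
    exact congrArg Sum.inl (Quotient.sound h5)
  · intro x O hOut
    have noret : ∀ i j, i < j → α (f^[i] x) ∈ Out → g (f^[i] x) = g (f^[j] x) → False := by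
      intro i j hlt' hi hgij
      apply (αout _ hi).1
      have orb : ∀ k, Rch f Set.univ δ' k (f^[i] x) (f^[i + k] x) := by
        intro k
        induction k with
        | zero => exact ⟨rfl, Set.mem_univ _⟩
        | succ k ih =>
          refine ⟨_, ih, ?_, Set.mem_univ _⟩
          rw [← Function.iterate_succ_apply' f, ← Nat.add_assoc]
          simp [hδ'.le]
      obtain ⟨k, rfl⟩ : ∃ k, j = i + k + 1 := ⟨j - i - 1, by omega⟩
      have cyc : Rch f Set.univ δ' (k + 1) (f^[i] x) (f^[i] x) := by
        refine ⟨_, orb k, ?_, Set.mem_univ _⟩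
        rw [← Function.iterate_succ_apply' f]
        have h4 := hg (f^[i] x)
        have h5 := hg (f^[i + k + 1] x)
        rw [← hgij] at h5
        have h6 := dist_triangle_right (f^[i + k + 1] x) (f^[i] x) (g (f^[i] x) : X)
        have h7 := min_le_left (δ' / 2) (ε / 2)
        show dist (f^[i + k + 1] x) (f^[i] x) ≤ δ'
        linarith
      obtain ⟨z, hz, hd⟩ := hnear _ _ (Nat.succ_pos k) cyc
      exact ⟨⟨z, hz⟩, hd⟩
    rw [← Finset.card_univ]
    refine Finset.card_le_card_of_injOn (fun i => g (f^[i] x))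
      (fun i _ => Finset.mem_coe.2 (Finset.mem_univ _)) ?_
    intro i hi j hj hij
    have hi' := hOut i (Finset.mem_coe.1 hi)
    have hj' := hOut j (Finset.mem_coe.1 hj)
    rcases lt_trichotomy i j with h | h | h
    · exact (noret i j h hi' hij).elim
    · exact h
    · exact (noret j i h hj' hij.symm).elim

open Dynamics ExpGrowth in
theorem entropy_pos [CompactSpace X] {f : X → X} (h : ShadowingOnCR f) {x y : X}
    (hxy : x ≠ y) (hr : ChainRel f x y) : 0 < coverEntropy f Set.univ := by
  have hd : 0 < dist x y := dist_pos.2 hxy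
  obtain ⟨ε, hε, hε4⟩ : ∃ ε > 0, 4 * ε = dist x y := ⟨dist x y / 4, by positivity, by ring⟩
  obtain ⟨δ, hδ, hsh⟩ := h ε hε
  obtain ⟨m, hm, N, hN, hch⟩ := (chainRel_iff f x y).1 hr δ hδ
  obtain ⟨L, hL⟩ : ∃ L, L = m * N + m * N := ⟨_, rfl⟩
  have hLpos : 0 < L := by
    have := Nat.mul_pos hm hN
    omega
  have a1 := hch N le_rfl
  have a2 := hch (N + N) (by omega)
  rw [Nat.mul_add, ← hL] at a2
  let pt : Bool → X := fun b => if b then x else y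
  have hc : ∀ b b', Rch f (CR f) δ L (pt b) (pt b') := by
    rintro (_ | _) (_ | _)
    · exact hL ▸ a1.2.trans a1.1
    · exact a2.2
    · exact a2.1
    · exact hL ▸ a1.1.trans a1.2
  simp only [rch_iff] at hc
  choose c hc1 hc2 hc3 hc4 using hc
  have shadow : ∀ w : ℕ → Bool, ∃ p, ∀ j, dist (f^[L * j] p) (pt (w j)) ≤ ε := by
    intro w
    obtain ⟨p, -, hp⟩ := hsh (fun i => c (w (i / L)) (w (i / L + 1)) (i % L))
      (fun i => hc2 _ _ _ (Nat.mod_lt _ hLpos).le) (by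
        intro i
        have hi := Nat.mod_lt i hLpos
        rcases Nat.lt_or_ge (i % L + 1) L with hlt | hge
        · have e1 : (i + 1) / L = i / L := by
            rw [Nat.succ_div, if_neg, Nat.add_zero]
            intro hdvd
            have := Nat.mod_eq_zero_of_dvd hdvd
            rw [Nat.add_mod, Nat.mod_eq_of_lt (show 1 < L by omega), Nat.mod_eq_of_lt hlt] at this
            omega
          have e2 : (i + 1) % L = i % L + 1 := by
            rw [Nat.add_mod, Nat.mod_eq_of_lt (show 1 < L by omega), Nat.mod_eq_of_lt hlt]
          rw [e1, e2]
          exact hc1 _ _ _ hi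
        · have e0 : i % L + 1 = L := by omega
          have e3 : i + 1 = L * (i / L + 1) := by
            have := Nat.div_add_mod i L
            rw [Nat.mul_add]
            omega
          have e1 : (i + 1) / L = i / L + 1 := by
            rw [e3, Nat.mul_div_cancel_left _ hLpos]
          have e2 : (i + 1) % L = 0 := by rw [e3, Nat.mul_mod_right]
          rw [e1, e2, hc3]
          have := hc1 (w (i / L)) (w (i / L + 1)) _ hi
          rwa [e0, hc4] at this)
    refine ⟨p, fun j => ?_⟩
    have := hp (L * j)
    rwa [Nat.mul_div_cancel_left _ hLpos, Nat.mul_mod_right, hc3] at this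
  choose p hp using shadow
  let U : SetRel X X := {q | dist q.1 q.2 < ε}
  have hU : U ∈ uniformity X := Metric.dist_mem_uniformity hε
  have hcount : ∀ n, ((2 ^ n : ℕ) : ℕ∞) ≤ netMaxcard f Set.univ U (L * n) := by
    intro n
    let ext : (Fin n → Bool) → ℕ → Bool := fun v j => if hj : j < n then v ⟨j, hj⟩ else true
    let P : (Fin n → Bool) → X := fun v => p (ext v)
    have sep : ∀ v v' z, z ∈ UniformSpace.ball (P v) (dynEntourage f U (L * n)) →
        z ∈ UniformSpace.ball (P v') (dynEntourage f U (L * n)) → v = v' := by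
      intro v v' z h1 h2
      by_contra hne
      obtain ⟨j, hj⟩ := Function.ne_iff.1 hne
      have hjn : L * (j : ℕ) < L * n := Nat.mul_lt_mul_of_pos_left j.2 hLpos
      have b1 : dist (f^[L * j] (P v)) (f^[L * j] z) < ε := mem_ball_dynEntourage.1 h1 _ hjn
      have b2 : dist (f^[L * j] (P v')) (f^[L * j] z) < ε := mem_ball_dynEntourage.1 h2 _ hjn
      have b3 := hp (ext v) j
      have b4 := hp (ext v') j
      have e1 : ext v j = v j := by simp [ext]
      have e2 : ext v' j = v' j := by simp [ext]
      rw [e1] at b3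
      rw [e2] at b4
      have hdd : dist (pt (v j)) (pt (v' j)) = dist x y := by
        cases hv : v j <;> cases hv' : v' j <;> simp_all [pt, dist_comm]
      have t1 := dist_triangle_left (pt (v j)) (pt (v' j)) (f^[L * j] z)
      have t2 := dist_triangle_left (f^[L * j] z) (pt (v j)) (f^[L * j] (P v))
      have t3 := dist_triangle_left (f^[L * j] z) (pt (v' j)) (f^[L * j] (P v'))
      change dist (f^[L * j] (P v)) _ ≤ ε at b3
      change dist (f^[L * j] (P v')) _ ≤ ε at b4
      linarith
    have self : ∀ q, q ∈ UniformSpace.ball q (dynEntourage f U (L * n)) := by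
      intro q
      rw [mem_ball_dynEntourage]
      intro k _
      show dist _ _ < ε
      simpa using hε
    have inj : Function.Injective P := by
      intro v v' hvv
      exact sep v v' (P v) (self _) (hvv ▸ self _)
    have hnet : IsDynNetIn f Set.univ U (L * n) ((Finset.univ.image P : Finset X) : Set X) := by
      refine ⟨Set.subset_univ _, ?_⟩
      intro a ha b hb hab
      simp only [Finset.coe_image, Finset.coe_univ, Set.image_univ, Set.mem_range] at ha hb
      obtain ⟨v, rfl⟩ := ha
      obtain ⟨v', rfl⟩ := hb
      refine Set.disjoint_left.2 fun z hz hz' => hab ?_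
      rw [sep v v' z hz hz']
    have := hnet.card_le_netMaxcard
    rw [Finset.card_image_of_injective _ inj] at this
    simpa using this
  have hle := netEntropyEntourage_le_coverEntropy f Set.univ hU
  refine lt_of_lt_of_le ?_ hle
  have mono : Monotone fun n => ((netMaxcard f Set.univ U n : ℕ∞) : ENNReal) :=
    fun a b hab => ENat.toENNReal_mono (netMaxcard_monotone_time f Set.univ U hab)
  have hmul := mono.expGrowthSup_comp_mul hLpos.ne'
  have hlow : ENNReal.log 2 ≤
      expGrowthSup ((fun n => ((netMaxcard f Set.univ U n : ℕ∞) : ENNReal)) ∘ fun n => L * n) := by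
    rw [← expGrowthSup_pow]
    refine expGrowthSup_monotone fun n => ?_
    have := ENat.toENNReal_mono (hcount n)
    simpa using this
  have hlog : (0 : EReal) < ENNReal.log 2 := by
    rw [← ENNReal.log_one]
    exact ENNReal.log_strictMono (by norm_num)
  by_contra! hneg
  have hn : expGrowthSup (fun n => ((netMaxcard f Set.univ U n : ℕ∞) : ENNReal)) ≤ 0 := hneg
  have : (L : EReal) * expGrowthSup (fun n => ((netMaxcard f Set.univ U n : ℕ∞) : ENNReal)) ≤ 0 :=
    mul_nonpos_of_nonneg_of_nonpos (by positivity) hn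
  have h1 := hlog.trans_le hlow
  have h2 := hmul ▸ h1
  exact absurd h2 (not_lt.2 this)

end Aux

/-- under shadowing on `CR f`, positive entropy is equivalent to
the existence of a non-diagonal chain related pair. -/
theorem pos_entropy_iff_chainRel_pair {X : Type*} [MetricSpace X] [CompactSpace X]
    (f : X → X) (hf : Continuous f) (h : ShadowingOnCR f) :
    0 < Dynamics.coverEntropy f Set.univ ↔
      ∃ x y : X, x ∈ CR f ∧ y ∈ CR f ∧ x ≠ y ∧ ChainRel f x y := by
  constructor
  · intro hpos
    by_contra! hcon
    refine absurd hpos (not_lt.2 (entropy_zero hf fun x y hx hy hxy => ?_))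
    by_contra hne
    exact hcon x y hx hy hne hxy
  · rintro ⟨x, y, -, -, hne, hxy⟩
    exact entropy_pos h hne hxy
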